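/- Let G be a simple graph on [0,n] and F ⊆ E(G\0), and suppose the flow polytope F_{H_G}(b_G^F) is nonempty. For I ⊆ [n], define z_I^F = min { Σ_{i∈I} f(i,t) : f a flow on H_G with netflow b_G^F } (so z_∅^F = 0). Then the parameters z_I^F are supermodular: for all I, J ⊆ [n], z_{I∪J}^F + z_{I∩J}^F ≥ z_I^F + z_J^F. -/

import Mathlib

noncomputable section

open Finset

/-- The flow polytope of a directed graph with edge index set `ι`, edges `e` going from
`src e` to `tgt e`, and netflow vector `a`. -/
def flowPolytope {V ι : Type*} [Fintype ι] [DecidableEq V]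
    (src tgt : ι → V) (a : V → ℝ) : Set (ι → ℝ) :=
  {f | (∀ e, 0 ≤ f e) ∧
    ∀ v, (∑ e, if src e = v then f e else 0) - (∑ e, if tgt e = v then f e else 0) = a v}

/-- `E(G\0)`: the edges of `G` not incident to the vertex `0`. -/
def EG0 (n : ℕ) (G : Finset (Fin (n + 1) × Fin (n + 1))) :
    Finset (Fin (n + 1) × Fin (n + 1)) :=
  G.filter fun e => (e.1 : ℕ) ≠ 0

/-- Source map of the graph `H_G` on the vertex set `[n] ∪ {t}` (modeled as
`Option (Fin (n+1))` with `none = t`; the vertex `some 0` is unused): the edges are the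
edges `(j,i)` of `G` with `1 ≤ j < i ≤ n` together with one edge `(j,t)` for each
`j ∈ [n]`. -/
def srcH (n : ℕ) (G : Finset (Fin (n + 1) × Fin (n + 1))) :
    (↥(EG0 n G) ⊕ Fin n) → Option (Fin (n + 1))
  | Sum.inl e => some e.1.1
  | Sum.inr i => some i.succ

/-- Target map of `H_G`. -/
def tgtH (n : ℕ) (G : Finset (Fin (n + 1) × Fin (n + 1))) :
    (↥(EG0 n G) ⊕ Fin n) → Option (Fin (n + 1))
  | Sum.inl e => some e.1.2
  | Sum.inr _ => none

/-- `indeg_G(v)`: number of edges of `G` ending at `v`. -/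
def indeg (n : ℕ) (G : Finset (Fin (n + 1) × Fin (n + 1))) (v : Fin (n + 1)) : ℕ :=
  (G.filter fun e => e.2 = v).card

/-- `outdeg_F(v)`: number of edges of `F` starting at `v`. -/
def outdeg (n : ℕ) (F : Finset (Fin (n + 1) × Fin (n + 1))) (v : Fin (n + 1)) : ℕ :=
  (F.filter fun e => e.1 = v).card

/-- The netflow vector `b_G^F = (indeg_G(1) − outdeg_F(1), …, indeg_G(n) − outdeg_F(n),
−#E(G\F))` on the vertices of `H_G`. -/
def bGF (n : ℕ) (G F : Finset (Fin (n + 1) × Fin (n + 1))) : Option (Fin (n + 1)) → ℝ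
  | none => -((G.card : ℝ) - (F.card : ℝ))
  | some v => if v = 0 then 0 else (indeg n G v : ℝ) - (outdeg n F v : ℝ)

/-- `z_I^F = min { ∑_{i∈I} f(i,t) : f a flow on H_G with netflow b_G^F }`. -/
def zI (n : ℕ) (G F : Finset (Fin (n + 1) × Fin (n + 1))) (I : Finset (Fin n)) : ℝ :=
  sInf ((fun f => ∑ i ∈ I, f (Sum.inr i)) ''
    flowPolytope (srcH n G) (tgtH n G) (bGF n G F))

/-- The netflow of `f` at `v`: flow out of `v` minus flow into `v`. -/
def netflow {V ι : Type*} [Fintype ι] [DecidableEq V]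
    (src tgt : ι → V) (f : ι → ℝ) (v : V) : ℝ :=
  (∑ e, if src e = v then f e else 0) - (∑ e, if tgt e = v then f e else 0)

section Flow

variable {V ι : Type*} [Fintype ι] [DecidableEq V] {src tgt : ι → V} {a : V → ℝ}

theorem mem_flowPolytope_iff {f : ι → ℝ} :
    f ∈ flowPolytope src tgt a ↔ (∀ e, 0 ≤ f e) ∧ ∀ v, netflow src tgt f v = a v :=
  Iff.rfl

theorem netflow_eq_sum (f : ι → ℝ) (v : V) :
    netflow src tgt f v =
      ∑ e, f e * ((if src e = v then 1 else 0) - (if tgt e = v then 1 else 0)) := by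
  simp only [netflow, ← Finset.sum_sub_distrib, mul_sub, mul_ite, mul_one, mul_zero]

theorem netflow_add (f g : ι → ℝ) (v : V) :
    netflow src tgt (f + g) v = netflow src tgt f v + netflow src tgt g v := by
  simp only [netflow_eq_sum, Pi.add_apply, add_mul, Finset.sum_add_distrib]

theorem netflow_smul (c : ℝ) (f : ι → ℝ) (v : V) :
    netflow src tgt (c • f) v = c * netflow src tgt f v := by
  simp only [netflow_eq_sum, Pi.smul_apply, smul_eq_mul, Finset.mul_sum, mul_assoc]

theorem netflow_single [DecidableEq ι] (e : ι) (c : ℝ) (v : V) :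
    netflow src tgt (Pi.single e c) v =
      c * ((if src e = v then 1 else 0) - (if tgt e = v then 1 else 0)) := by
  rw [netflow_eq_sum, Finset.sum_eq_single e]
  · simp
  · intro x _ hx
    simp [Pi.single_eq_of_ne hx]
  · simp

theorem sum_mul_netflow [Fintype V] (h : V → ℝ) (f : ι → ℝ) :
    ∑ v, h v * netflow src tgt f v = ∑ e, f e * (h (src e) - h (tgt e)) := by
  simp only [netflow_eq_sum, Finset.mul_sum]
  rw [Finset.sum_comm]
  refine Finset.sum_congr rfl fun e _ => ?_
  simp only [mul_sub, mul_ite, mul_one, mul_zero, Finset.sum_sub_distrib, Finset.sum_ite_eq,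
    Finset.mem_univ, if_true]
  ring

theorem sum_netflow_eq [Fintype V] (f : ι → ℝ) (S : Finset V) :
    ∑ v ∈ S, netflow src tgt f v =
      ∑ e, f e * ((if src e ∈ S then 1 else 0) - (if tgt e ∈ S then 1 else 0)) := by
  rw [← sum_mul_netflow (fun v => if v ∈ S then 1 else 0)]
  simp

theorem isCompact_flowPolytope [Fintype V] (h : V → ℝ)
    (hh : ∀ e, h (tgt e) + 1 ≤ h (src e)) : IsCompact (flowPolytope src tgt a) := by
  have hclosed : IsClosed (flowPolytope src tgt a) := by
    have : flowPolytope src tgt a =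
        (⋂ e, {f | 0 ≤ f e}) ∩ ⋂ v, {f | netflow src tgt f v = a v} := by
      ext f
      simp [mem_flowPolytope_iff]
    rw [this]
    refine (isClosed_iInter fun e => isClosed_le (by fun_prop) (by fun_prop)).inter
      (isClosed_iInter fun v => isClosed_eq ?_ (by fun_prop))
    simp only [netflow_eq_sum]
    fun_prop
  refine (isCompact_Icc (a := fun _ => 0) (b := fun _ => ∑ v, h v * a v)).of_isClosed_subset
    hclosed fun f hf => ⟨hf.1, fun e => ?_⟩
  obtain ⟨hf0, hfa⟩ := mem_flowPolytope_iff.1 hf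
  calc f e ≤ ∑ e, f e := Finset.single_le_sum (fun e _ => hf0 e) (Finset.mem_univ e)
    _ ≤ ∑ e, f e * (h (src e) - h (tgt e)) :=
      Finset.sum_le_sum fun e _ => by nlinarith [hf0 e, hh e]
    _ = ∑ v, h v * a v := by simp only [← sum_mul_netflow, hfa]

/-- If every edge leaving `S` lies in `K`, then the netflow of `S` bounds the flow on `K`. -/
theorem sum_le_of_leaving_subset [Fintype V] {K : Finset ι} {S : Finset V}
    (hS : ∀ e, src e ∈ S → tgt e ∉ S → e ∈ K) {f : ι → ℝ} (hf : f ∈ flowPolytope src tgt a) :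
    ∑ v ∈ S, a v ≤ ∑ e ∈ K, f e := by
  classical
  obtain ⟨hf0, hfa⟩ := mem_flowPolytope_iff.1 hf
  simp only [← hfa]
  rw [sum_netflow_eq, ← Finset.sum_indicator_subset f (Finset.subset_univ K)]
  refine Finset.sum_le_sum fun e _ => ?_
  have h0 := hf0 e
  have hSe := hS e
  simp only [Set.indicator_apply, Finset.mem_coe]
  split_ifs <;> first | (exfalso; tauto) | linarith

/-- `CanPush f K t v`: starting from `f`, a positive amount of flow can be sent from `v` to `t`
through the residual graph without increasing the total flow on `K`. -/
def CanPush (src tgt : ι → V) (f : ι → ℝ) (K : Finset ι) (t v : V) : Prop :=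
  ∃ (p : ι → ℝ) (δ : ℝ), 0 < δ ∧ (∀ e, 0 ≤ f e + p e) ∧
    (∀ u, netflow src tgt p u = δ * ((if v = u then 1 else 0) - (if t = u then 1 else 0))) ∧
    ∑ e ∈ K, p e ≤ 0

theorem canPush_self {f : ι → ℝ} (hf : ∀ e, 0 ≤ f e) (K : Finset ι) (t : V) :
    CanPush src tgt f K t t :=
  ⟨0, 1, one_pos, by simpa using hf, by simp [netflow_eq_sum], by simp⟩

theorem CanPush.src_of_tgt {f : ι → ℝ} {K : Finset ι} {t : V} {e : ι} (he : e ∉ K)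
    (h : CanPush src tgt f K t (tgt e)) : CanPush src tgt f K t (src e) := by
  classical
  obtain ⟨p, δ, hδ, hp, hnet, hK⟩ := h
  refine ⟨p + Pi.single e δ, δ, hδ, fun x => ?_, fun u => ?_, ?_⟩
  · have : 0 ≤ (Pi.single e δ : ι → ℝ) x := by
      rw [Pi.single_apply]; split_ifs <;> linarith
    have := hp x
    simp only [Pi.add_apply]
    linarith
  · rw [netflow_add, hnet, netflow_single]
    ring
  · simpa [Finset.sum_add_distrib, Finset.sum_pi_single', he] using hK

/-- Flow on an edge `e` can be rerouted from its source: the flow on `K` drops if `e ∈ K`. -/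
theorem CanPush.exists_reroute [DecidableEq ι] {f : ι → ℝ} {K : Finset ι} {t : V} {e : ι}
    (hf : ∀ e, 0 ≤ f e) (he : 0 < f e) (h : CanPush src tgt f K t (src e)) :
    ∃ (p : ι → ℝ) (δ : ℝ), 0 < δ ∧ (∀ e, 0 ≤ f e + p e) ∧
      (∀ u, netflow src tgt p u =
        δ * ((if tgt e = u then 1 else 0) - (if t = u then 1 else 0))) ∧
      ∑ e ∈ K, p e ≤ if e ∈ K then -δ else 0 := by
  obtain ⟨p, δ, hδ, hp, hnet, hK⟩ := h
  obtain ⟨c, hc, hc1, hce⟩ : ∃ c : ℝ, 0 < c ∧ c ≤ 1 ∧ c * (f e + δ) = f e :=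
    ⟨f e / (f e + δ), by positivity, by rw [div_le_one (by positivity)]; linarith,
      by field_simp⟩
  refine ⟨c • p + Pi.single e (-(c * δ)), c * δ, by positivity, fun x => ?_, fun u => ?_, ?_⟩
  · have h1 := mul_nonneg hc.le (hp x)
    have h2 := mul_nonneg (sub_nonneg.2 hc1) (hf x)
    simp only [Pi.add_apply, Pi.smul_apply, smul_eq_mul, Pi.single_apply]
    split_ifs with hx
    · subst hx
      linarith
    · linarith
  · rw [netflow_add, netflow_smul, hnet, netflow_single]
    ring
  · have := mul_nonpos_of_nonneg_of_nonpos hc.le hK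
    simp only [Pi.add_apply, Pi.smul_apply, smul_eq_mul, Finset.sum_add_distrib,
      Finset.sum_pi_single', ← Finset.mul_sum]
    split_ifs <;> linarith

/-- Max-flow min-cut duality: the minimal flow on a set `K` of edges ending at `t` is the netflow
of some vertex set `S` not containing `t` all of whose leaving edges lie in `K`. -/
theorem exists_sum_eq_of_isMinOn [Fintype V] {K : Finset ι} {t : V} (hK : ∀ e ∈ K, tgt e = t)
    {f : ι → ℝ} (hf : f ∈ flowPolytope src tgt a)
    (hmin : IsMinOn (fun g : ι → ℝ => ∑ e ∈ K, g e) (flowPolytope src tgt a) f) :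
    ∃ S : Finset V, t ∉ S ∧ (∀ e, src e ∈ S → tgt e ∉ S → e ∈ K) ∧
      ∑ e ∈ K, f e = ∑ v ∈ S, a v := by
  classical
  obtain ⟨hf0, hfa⟩ := mem_flowPolytope_iff.1 hf
  have hout : ∀ e ∉ K, CanPush src tgt f K t (tgt e) → CanPush src tgt f K t (src e) :=
    fun e he h => h.src_of_tgt he
  have hin : ∀ e ∉ K, 0 < f e → CanPush src tgt f K t (src e) →
      CanPush src tgt f K t (tgt e) := by
    intro e he hpos h
    obtain ⟨p, δ, hδ, hp, hnet, hs⟩ := h.exists_reroute hf0 hpos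
    exact ⟨p, δ, hδ, hp, hnet, by simpa [he] using hs⟩
  have hsat : ∀ e ∈ K, 0 < f e → ¬ CanPush src tgt f K t (src e) := by
    intro e he hpos h
    obtain ⟨p, δ, hδ, hp, hnet, hs⟩ := h.exists_reroute hf0 hpos
    have hmem : f + p ∈ flowPolytope src tgt a :=
      mem_flowPolytope_iff.2 ⟨hp, fun v => by simp [netflow_add, hnet, hK e he, hfa]⟩
    have := isMinOn_iff.1 hmin _ hmem
    simp only [Pi.add_apply, Finset.sum_add_distrib] at this
    rw [if_pos he] at hs
    linarith
  have ht : CanPush src tgt f K t t := canPush_self hf0 K t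
  refine ⟨Finset.univ.filter fun v => ¬ CanPush src tgt f K t v, by simpa using ht, ?_, ?_⟩
  · intro e h1 h2
    simp only [Finset.mem_filter, Finset.mem_univ, true_and, not_not] at h1 h2
    by_contra he
    exact h1 (hout e he h2)
  · simp only [← hfa]
    rw [sum_netflow_eq, ← Finset.sum_indicator_subset f (Finset.subset_univ K)]
    refine Finset.sum_congr rfl fun e _ => ?_
    simp only [Set.indicator_apply, Finset.mem_coe, Finset.mem_filter, Finset.mem_univ,
      true_and]
    have := hout e
    have := hin e
    have := hsat e
    have htgt : e ∈ K → CanPush src tgt f K t (tgt e) := fun he => (hK e he).symm ▸ ht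
    rcases (hf0 e).eq_or_lt with h0 | hpos
    · simp [← h0]
    · split_ifs <;> first | (exfalso; tauto) | ring

/-- Supermodularity of minimal flow on sets of edges ending at `t`. -/
theorem sInf_flow_supermodular [Fintype V] [DecidableEq ι] (h : V → ℝ)
    (hh : ∀ e, h (tgt e) + 1 ≤ h (src e)) (hne : (flowPolytope src tgt a).Nonempty) {t : V}
    {K L : Finset ι} (hK : ∀ e ∈ K, tgt e = t) (hL : ∀ e ∈ L, tgt e = t) :
    sInf ((fun f : ι → ℝ => ∑ e ∈ K, f e) '' flowPolytope src tgt a) +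
        sInf ((fun f : ι → ℝ => ∑ e ∈ L, f e) '' flowPolytope src tgt a) ≤
      sInf ((fun f : ι → ℝ => ∑ e ∈ K ∪ L, f e) '' flowPolytope src tgt a) +
        sInf ((fun f : ι → ℝ => ∑ e ∈ K ∩ L, f e) '' flowPolytope src tgt a) := by
  have hcut : ∀ M : Finset ι, (∀ e ∈ M, tgt e = t) →
      ∃ S : Finset V, t ∉ S ∧ (∀ e, src e ∈ S → tgt e ∉ S → e ∈ M) ∧
        sInf ((fun f : ι → ℝ => ∑ e ∈ M, f e) '' flowPolytope src tgt a) = ∑ v ∈ S, a v := by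
    intro M hM
    obtain ⟨f, hf, hmin⟩ := (isCompact_flowPolytope h hh).exists_isMinOn hne
      (f := fun f : ι → ℝ => ∑ e ∈ M, f e) (by fun_prop)
    obtain ⟨S, htS, hS, hsum⟩ := exists_sum_eq_of_isMinOn hM hf hmin
    refine ⟨S, htS, hS, hsum ▸ IsLeast.csInf_eq ⟨⟨f, hf, rfl⟩, ?_⟩⟩
    rintro _ ⟨g, hg, rfl⟩
    exact isMinOn_iff.1 hmin g hg
  have hle : ∀ (M : Finset ι) (S : Finset V), (∀ e, src e ∈ S → tgt e ∉ S → e ∈ M) →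
      ∑ v ∈ S, a v ≤ sInf ((fun f : ι → ℝ => ∑ e ∈ M, f e) '' flowPolytope src tgt a) := by
    intro M S hS
    refine le_csInf (hne.image _) ?_
    rintro _ ⟨g, hg, rfl⟩
    exact sum_le_of_leaving_subset hS hg
  obtain ⟨S, htS, hS, hSsum⟩ := hcut K hK
  obtain ⟨T, htT, hT, hTsum⟩ := hcut L hL
  rw [hSsum, hTsum, ← Finset.sum_union_inter]
  refine add_le_add (hle _ _ fun e h1 h2 => ?_) (hle _ _ fun e h1 h2 => ?_)
  · simp only [Finset.mem_union, not_or] at h1 h2 ⊢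
    exact h1.imp (hS e · h2.1) (hT e · h2.2)
  · simp only [Finset.mem_inter, not_and_or] at h1 h2 ⊢
    have ht : tgt e = t := h2.elim (fun h => hK e (hS e h1.1 h)) fun h => hL e (hT e h1.2 h)
    exact ⟨hS e h1.1 (ht ▸ htS), hT e h1.2 (ht ▸ htT)⟩

end Flow

/-- for a simple graph `G` on `[0,n]` and `F ⊆ E(G\0)` with
`F_{H_G}(b_G^F)` nonempty, the parameters `z_I^F` are supermodular. -/
theorem zI_supermodular (n : ℕ) (G : Finset (Fin (n + 1) × Fin (n + 1)))
    (hG : ∀ e ∈ G, e.1 < e.2) (F : Finset (Fin (n + 1) × Fin (n + 1)))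
    (hF : F ⊆ EG0 n G)
    (hne : (flowPolytope (srcH n G) (tgtH n G) (bGF n G F)).Nonempty) :
    ∀ I J : Finset (Fin n), zI n G F I + zI n G F J ≤ zI n G F (I ∪ J) + zI n G F (I ∩ J) := by
  intro I J
  have hz : ∀ I : Finset (Fin n), zI n G F I =
      sInf ((fun f : ↥(EG0 n G) ⊕ Fin n → ℝ => ∑ e ∈ I.map Function.Embedding.inr, f e) ''
        flowPolytope (srcH n G) (tgtH n G) (bGF n G F)) := by
    intro I
    simp only [zI, Finset.sum_map, Function.Embedding.inr_apply]
  have ht : ∀ I : Finset (Fin n), ∀ e ∈ I.map (Function.Embedding.inr (α := ↥(EG0 n G))),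
      tgtH n G e = none := by
    intro I e he
    obtain ⟨i, -, rfl⟩ := Finset.mem_map.1 he
    rfl
  rw [hz, hz, hz, hz, Finset.map_union, Finset.map_inter]
  refine sInf_flow_supermodular
    (fun v => v.elim (-(n + 1 : ℝ)) fun w => -((w : ℕ) : ℝ)) ?_ hne (ht I) (ht J)
  rintro (⟨e, he⟩ | i)
  · have h1 : (e.1 : ℕ) + 1 ≤ e.2 := hG e (Finset.mem_filter.1 he).1
    have h2 : ((e.1 : ℕ) : ℝ) + 1 ≤ (e.2 : ℕ) := by exact_mod_cast h1
    simp only [srcH, tgtH, Option.elim]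
    linarith
  · have h2 : ((i : ℕ) : ℝ) + 1 ≤ n := by exact_mod_cast i.isLt
    simp only [srcH, tgtH, Option.elim, Fin.val_succ, Nat.cast_add, Nat.cast_one]
    linarith
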